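/- arXiv:2104.10528 — 7 statements merged into one kernel-verified Lean document; each statement's English description precedes it below -/
import Mathlib

section
/- Consider an activation-independent escape model with marginal μ on (γ,ξ). Fix k > 0 and assume 1 < m := ∫ 1_{γ≥k}·ξ dμ < ∞; let g = μ({γ ≥ k} ∩ {ξ = 1}) and q_c = (1 − g)/(m − g). For q ∈ (q_c, 1] let α(q) be the smallest fixed point in [0,1] of f_{k,q}(x) = 1 − G(1−x) + q·[G(x) + G(1−x) − G(0) − G(1)], where G(x) = ∫ 1_{γ≥k}·x^ξ dμ, and set β(q) = 1 − α(q) (which is positive for q > q_c). Then, as q ↓ q_c: α(q) → 1; (G(1) − G(α(q)))/β(q) → m; and G(β(q))/β(q) → g. -/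
open MeasureTheory Set Filter Topology
open scoped ENNReal NNReal

lemma one_sub_pow_sub_pow_le {b : ℝ} (hb : b ∈ Icc (0 : ℝ) 1) {n : ℕ} (hn : 2 ≤ n) :
    1 - b ^ n - (1 - b) ^ n ≤ n * (b * (1 - b)) := by
  have hc : (1 - b) ∈ Icc (0 : ℝ) 1 := ⟨by linarith [hb.2], by linarith [hb.1]⟩
  induction n, hn using Nat.le_induction with
  | base => push_cast; nlinarith
  | succ n hn ih =>
    obtain ⟨j, rfl⟩ : ∃ j, n = j + 2 := ⟨n - 2, by lia⟩
    have h1 : b ^ (j + 1) ≤ b := by simpa using pow_le_pow_of_le_one hb.1 hb.2 (by lia : 1 ≤ j + 1)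
    have h2 : (1 - b) ^ (j + 1) ≤ 1 - b := by
      simpa using pow_le_pow_of_le_one hc.1 hc.2 (by lia : 1 ≤ j + 1)
    have h3 : b * (1 - b) * (b ^ (j + 1) + (1 - b) ^ (j + 1)) ≤ b * (1 - b) :=
      mul_le_of_le_one_right (mul_nonneg hb.1 hc.1) (by linarith)
    push_cast at ih ⊢
    have e : 1 - b ^ (j + 2 + 1) - (1 - b) ^ (j + 2 + 1) = 1 - b ^ (j + 2) - (1 - b) ^ (j + 2)
      + b * (1 - b) * (b ^ (j + 1) + (1 - b) ^ (j + 1)) := by ring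
    linarith

/-- The generating function of a finite measure on `ℕ`. -/
noncomputable def genFun (ν : Measure ℕ) (x : ℝ) : ℝ := ∫ n, x ^ n ∂ν

section GenFun

variable {ν : Measure ℕ}

lemma genFun_zero (h0 : ν {0} = 0) : genFun ν 0 = 0 := by
  refine integral_eq_zero_of_ae ?_
  have : ∀ᵐ n ∂ν, n ≠ 0 := by simpa [ae_iff] using h0
  filter_upwards [this] with n hn
  simp [hn]

lemma genFun_one : genFun ν 1 = ν.real univ := by simp [genFun]

variable [IsFiniteMeasure ν]

lemma integrable_pow_of_mem_Icc {x : ℝ} (hx : x ∈ Icc (0 : ℝ) 1) :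
    Integrable (fun n : ℕ => x ^ n) ν := by
  refine Integrable.of_bound (Measurable.of_discrete.aestronglyMeasurable) 1 (ae_of_all _ fun n => ?_)
  rw [Real.norm_of_nonneg (pow_nonneg hx.1 n)]
  exact pow_le_one₀ hx.1 hx.2

lemma integrable_indicator_one : Integrable (({1} : Set ℕ).indicator (1 : ℕ → ℝ)) ν :=
  (integrable_const (1 : ℝ)).indicator (measurableSet_singleton 1)

lemma continuousOn_genFun : ContinuousOn (genFun ν) (Icc 0 1) := by
  refine continuousOn_of_dominated (bound := fun _ => 1)
    (fun x _ => Measurable.of_discrete.aestronglyMeasurable) (fun x hx => ae_of_all _ fun n => ?_)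
    (integrable_const 1) (ae_of_all _ fun n => (continuous_pow n).continuousOn)
  rw [Real.norm_of_nonneg (pow_nonneg hx.1 n)]
  exact pow_le_one₀ hx.1 hx.2

lemma genFun_le (h0 : ν {0} = 0) {b : ℝ} (hb : b ∈ Icc (0 : ℝ) 1) :
    genFun ν b ≤ ν.real {1} * b + (ν.real univ - ν.real {1}) * b ^ 2 := by
  have hae : ∀ᵐ n ∂ν, n ≠ 0 := by simpa [ae_iff] using h0
  have key : genFun ν b ≤
      ∫ n, (({1} : Set ℕ).indicator (1 : ℕ → ℝ) n * (b - b ^ 2) + b ^ 2) ∂ν := by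
    refine integral_mono_ae (integrable_pow_of_mem_Icc hb)
      ((integrable_indicator_one.mul_const _).add (integrable_const _)) ?_
    filter_upwards [hae] with n hn
    by_cases h1 : n = 1
    · simp [h1]
    · simpa [h1] using pow_le_pow_of_le_one hb.1 hb.2 (by lia : 2 ≤ n)
  rw [integral_add (integrable_indicator_one.mul_const _) (integrable_const _),
    integral_mul_const, integral_indicator_one (measurableSet_singleton 1), integral_const,
    smul_eq_mul] at key
  linarith

lemma sub_genFun_sub_genFun_le (h0 : ν {0} = 0) (hν : Integrable (fun n : ℕ => (n : ℝ)) ν)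
    {b : ℝ} (hb : b ∈ Icc (0 : ℝ) 1) :
    ν.real univ - genFun ν b - genFun ν (1 - b) ≤ (∫ n, (n : ℝ) ∂ν - ν.real {1}) * (b * (1 - b)) := by
  have hc : (1 - b) ∈ Icc (0 : ℝ) 1 := ⟨by linarith [hb.2], by linarith [hb.1]⟩
  have hae : ∀ᵐ n ∂ν, n ≠ 0 := by simpa [ae_iff] using h0
  have ib := integrable_pow_of_mem_Icc (ν := ν) hb
  have ic := integrable_pow_of_mem_Icc (ν := ν) hc
  have i1 : Integrable (fun _ : ℕ => (1 : ℝ)) ν := integrable_const 1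
  have i1b : Integrable (fun n : ℕ => 1 - b ^ n) ν := i1.sub ib
  have key : ∫ n, (1 - b ^ n - (1 - b) ^ n) ∂ν ≤
      ∫ n : ℕ, ((n - ({1} : Set ℕ).indicator (1 : ℕ → ℝ) n) * (b * (1 - b))) ∂ν := by
    refine integral_mono_ae (i1b.sub ic) ((hν.sub integrable_indicator_one).mul_const _) ?_
    filter_upwards [hae] with n hn
    by_cases h1 : n = 1
    · simp [h1]
    · simpa [h1] using one_sub_pow_sub_pow_le hb (by lia : 2 ≤ n)
  rw [integral_sub i1b ic, integral_sub i1 ib, integral_mul_const,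
    integral_sub hν integrable_indicator_one,
    integral_indicator_one (measurableSet_singleton 1), integral_const, smul_eq_mul, mul_one] at key
  exact key

lemma tendsto_genFun_div (h0 : ν {0} = 0) :
    Tendsto (fun b => genFun ν b / b) (𝓝[>] 0) (𝓝 (ν.real {1})) := by
  have hae : ∀ᵐ n ∂ν, n ≠ 0 := by simpa [ae_iff] using h0
  have hev : ∀ᶠ b : ℝ in 𝓝[>] 0, b ∈ Ioc (0 : ℝ) 1 := Ioc_mem_nhdsGT one_pos
  simp only [genFun, ← integral_div]
  rw [← integral_indicator_one (measurableSet_singleton 1)]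
  refine tendsto_integral_filter_of_dominated_convergence (fun _ => 1)
    (Eventually.of_forall fun _ => Measurable.of_discrete.aestronglyMeasurable) ?_
    (integrable_const 1) ?_
  · filter_upwards [hev] with b hb
    filter_upwards [hae] with n hn
    rw [Real.norm_of_nonneg (div_nonneg (pow_nonneg hb.1.le n) hb.1.le), div_le_one hb.1]
    exact pow_le_of_le_one hb.1.le hb.2 hn
  · filter_upwards [hae] with n hn
    obtain ⟨j, rfl⟩ := Nat.exists_eq_succ_of_ne_zero hn
    have : Tendsto (fun b : ℝ => b ^ j) (𝓝[>] 0) (𝓝 (0 ^ j)) :=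
      ((continuous_pow j).tendsto 0).mono_left nhdsWithin_le_nhds
    have e : ({1} : Set ℕ).indicator (1 : ℕ → ℝ) j.succ = 0 ^ j := by
      rcases j with _ | j <;> simp
    rw [e]
    refine this.congr' ?_
    filter_upwards [hev] with b hb
    rw [Nat.succ_eq_add_one, pow_succ, mul_div_cancel_right₀ _ hb.1.ne']

lemma tendsto_sub_genFun_div (hν : Integrable (fun n : ℕ => (n : ℝ)) ν) :
    Tendsto (fun b => (ν.real univ - genFun ν (1 - b)) / b) (𝓝[>] 0) (𝓝 (∫ n, (n : ℝ) ∂ν)) := by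
  have hev : ∀ᶠ b : ℝ in 𝓝[>] 0, b ∈ Ioc (0 : ℝ) 1 := Ioc_mem_nhdsGT one_pos
  have key : Tendsto (fun b : ℝ => ∫ n, (1 - (1 - b) ^ n) / b ∂ν) (𝓝[>] 0)
      (𝓝 (∫ n, (n : ℝ) ∂ν)) := by
    refine tendsto_integral_filter_of_dominated_convergence (fun n => (n : ℝ))
      (Eventually.of_forall fun _ => Measurable.of_discrete.aestronglyMeasurable) ?_ hν ?_
    · filter_upwards [hev] with b hb
      refine ae_of_all _ fun n => ?_
      have h1 : (1 - b) ^ n ≤ 1 := pow_le_one₀ (by linarith [hb.2]) (by linarith [hb.1])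
      rw [Real.norm_of_nonneg (div_nonneg (by linarith) hb.1.le), div_le_iff₀ hb.1]
      have h2 := one_add_mul_le_pow (by linarith [hb.2] : -2 ≤ -b) n
      rw [← sub_eq_add_neg] at h2
      linarith
    · refine ae_of_all _ fun n => ?_
      have hd : HasDerivAt (fun b : ℝ => 1 - (1 - b) ^ n) (n : ℝ) 0 := by
        have := (((hasDerivAt_id (0 : ℝ)).const_sub 1).pow n).const_sub 1
        simpa using this
      have := hd.tendsto_slope.mono_left
        (nhdsWithin_mono (0 : ℝ) (fun x (hx : 0 < x) => hx.ne' : Ioi (0 : ℝ) ⊆ {0}ᶜ))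
      refine this.congr fun b => ?_
      simp [slope_def_field]
  refine key.congr' ?_
  filter_upwards [hev] with b hb
  rw [integral_div, integral_sub (integrable_const 1)
    (integrable_pow_of_mem_Icc ⟨by linarith [hb.2], by linarith [hb.1]⟩)]
  simp [genFun]

/-- The survival probability `b = 1 - x` of a fixed point `x` of the value generating function
is at most proportional to the distance from criticality. -/
lemma fixedPoint_bound (h0 : ν {0} = 0) (hν : Integrable (fun n : ℕ => (n : ℝ)) ν)
    {q b : ℝ} (hq : 0 ≤ q) (hb : b ∈ Ioc (0 : ℝ) 1)
    (hfix : b = genFun ν b + q * (ν.real univ - genFun ν b - genFun ν (1 - b))) :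
    (1 - ν.real univ) * b ≤
      (q * (∫ n, (n : ℝ) ∂ν - ν.real {1}) - (1 - ν.real {1})) * (1 - b) := by
  have hb' : b ∈ Icc (0 : ℝ) 1 := ⟨hb.1.le, hb.2⟩
  have h1 := genFun_le h0 hb'
  have h2 := mul_le_mul_of_nonneg_left (sub_genFun_sub_genFun_le h0 hν hb') hq
  refine le_of_mul_le_mul_left ?_ hb.1
  linarith

lemma exists_fixedPoint (h0 : ν {0} = 0) (hν : Integrable (fun n : ℕ => (n : ℝ)) ν)
    (hP : ν.real univ < 1) {q : ℝ}
    (hq : 1 - ν.real {1} < q * (∫ n, (n : ℝ) ∂ν - ν.real {1})) :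
    ∃ b ∈ Ioc (0 : ℝ) 1,
      b = genFun ν b + q * (ν.real univ - genFun ν b - genFun ν (1 - b)) := by
  have hlim := (tendsto_genFun_div h0).add
    (((tendsto_sub_genFun_div hν).sub (tendsto_genFun_div h0)).const_mul q)
  obtain ⟨c, hc1, hc⟩ := ((hlim.eventually_const_lt (by linarith : (1 : ℝ) < _)).and
    (Ioc_mem_nhdsGT (one_pos : (0 : ℝ) < 1))).exists
  have hc2 : c < genFun ν c + q * (ν.real univ - genFun ν c - genFun ν (1 - c)) := by
    have := mul_lt_mul_of_pos_left hc1 hc.1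
    rw [mul_one] at this
    refine this.trans_eq ?_
    field_simp [hc.1.ne']
    ring
  have hcont : ContinuousOn
      (fun b => genFun ν b + q * (ν.real univ - genFun ν b - genFun ν (1 - b)) - b) (Icc c 1) := by
    have hG : ContinuousOn (genFun ν) (Icc c 1) :=
      continuousOn_genFun.mono (Icc_subset_Icc_left hc.1.le)
    have hG' : ContinuousOn (fun b => genFun ν (1 - b)) (Icc c 1) :=
      continuousOn_genFun.comp (by fun_prop)
        fun b hb => ⟨by linarith [hb.2], by linarith [hb.1, hc.1]⟩
    fun_prop
  obtain ⟨b, hb, hb0⟩ := intermediate_value_Icc' hc.2 hcont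
    (show (0 : ℝ) ∈ _ from ⟨by simp [genFun_one, genFun_zero h0, hP.le], by linarith⟩)
  exact ⟨b, ⟨hc.1.trans_le hb.1, hb.2⟩, by simp only at hb0; linarith⟩

end GenFun

/-- in an activation-independent escape model with marginal `μ` on `(γ,ξ)`,
for `k > 0` with `1 < m := ∫ 1_{γ≥k}·ξ dμ < ∞`, `g = μ({γ ≥ k} ∩ {ξ = 1})` and
`q_c = (1−g)/(m−g)`, letting `α(q)` be the smallest fixed point in `[0,1]` of
`f_{k,q}(x) = 1 − G(1−x) + q[G(x)+G(1−x)−G(0)−G(1)]` (where `G(x) = ∫ 1_{γ≥k}·x^ξ dμ`)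
and `β(q) = 1 − α(q)` (positive for `q ∈ (q_c,1]`), as `q ↓ q_c` within `(q_c,1]` one has
`α(q) → 1`, `(G(1) − G(α(q)))/β(q) → m`, and `G(β(q))/β(q) → g`. -/
theorem conditional_ratio_limits_at_critical
    (μ : Measure (ℝ≥0 × ℕ)) [IsProbabilityMeasure μ]
    (hesc1 : μ {s : ℝ≥0 × ℕ | 0 < s.1 ∧ s.2 = 0} = 0)
    (hesc2 : ∀ k' : ℝ≥0, 0 < k' → 0 < μ {s : ℝ≥0 × ℕ | s.1 < k'})
    (k : ℝ≥0) (hk : 0 < k)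
    (hm1 : 1 < ∫⁻ s in {s : ℝ≥0 × ℕ | k ≤ s.1}, (s.2 : ℝ≥0∞) ∂μ)
    (hm2 : (∫⁻ s in {s : ℝ≥0 × ℕ | k ≤ s.1}, (s.2 : ℝ≥0∞) ∂μ) < ⊤)
    (m g qc : ℝ)
    (hm : m = (∫⁻ s in {s : ℝ≥0 × ℕ | k ≤ s.1}, (s.2 : ℝ≥0∞) ∂μ).toReal)
    (hg : g = (μ {s : ℝ≥0 × ℕ | k ≤ s.1 ∧ s.2 = 1}).toReal)
    (hqc : qc = (1 - g) / (m - g))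
    (G : ℝ → ℝ) (hG : ∀ x : ℝ, G x = ∫ s in {s : ℝ≥0 × ℕ | k ≤ s.1}, x ^ s.2 ∂μ)
    (F : ℝ → ℝ → ℝ)
    (hF : ∀ q x : ℝ, F q x = 1 - G (1 - x) + q * (G x + G (1 - x) - G 0 - G 1))
    (A : ℝ → ℝ) (hA : ∀ q : ℝ, A q = sInf {x ∈ Set.Icc (0:ℝ) 1 | F q x = x}) :
    (∀ q ∈ Set.Ioc qc 1, 0 < 1 - A q) ∧
    Tendsto A (nhdsWithin qc (Set.Ioc qc 1)) (nhds 1) ∧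
    Tendsto (fun q : ℝ => (G 1 - G (A q)) / (1 - A q))
      (nhdsWithin qc (Set.Ioc qc 1)) (nhds m) ∧
    Tendsto (fun q : ℝ => G (1 - A q) / (1 - A q))
      (nhdsWithin qc (Set.Ioc qc 1)) (nhds g) := by
  set S : Set (ℝ≥0 × ℕ) := {s | k ≤ s.1} with hS
  have hSm : MeasurableSet S := measurableSet_le measurable_const measurable_fst
  set ν : Measure ℕ := (μ.restrict S).map Prod.snd with hνdef
  have hνapply (T : Set ℕ) : ν T = μ {s | k ≤ s.1 ∧ s.2 ∈ T} := by
    rw [hνdef, Measure.map_apply measurable_snd .of_discrete, Measure.restrict_apply' hSm]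
    congr 1
    ext s
    simp [hS, and_comm]
  have h0 : ν {0} = 0 := by
    rw [hνapply]
    refine measure_mono_null (fun s hs => ?_) hesc1
    exact ⟨hk.trans_le hs.1, hs.2⟩
  have hg' : g = ν.real {1} := by simp [hg, Measure.real, hνapply]
  have hGν : G = genFun ν := by
    funext x
    rw [hG, genFun, hνdef, integral_map measurable_snd.aemeasurable
      Measurable.of_discrete.aestronglyMeasurable]
  have hlint : ∫⁻ s in S, (s.2 : ℝ≥0∞) ∂μ = ∫⁻ n : ℕ, (n : ℝ≥0∞) ∂ν := by
    rw [hνdef, lintegral_map .of_discrete measurable_snd]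
  have hlint' : ∫⁻ n : ℕ, (n : ℝ≥0∞) ∂ν = ∫⁻ n : ℕ, ENNReal.ofReal (n : ℝ) ∂ν := by simp
  have hν : Integrable (fun n : ℕ => (n : ℝ)) ν := by
    refine ⟨Measurable.of_discrete.aestronglyMeasurable, ?_⟩
    rw [hasFiniteIntegral_iff_ofReal (ae_of_all _ fun n => Nat.cast_nonneg n), ← hlint', ← hlint]
    exact hm2
  have hm' : m = ∫ n, (n : ℝ) ∂ν := by
    rw [hm, hlint, hlint', integral_eq_lintegral_of_nonneg_ae
      (ae_of_all _ fun n => Nat.cast_nonneg n) hν.1]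
  have hm_gt : 1 < m := by
    rw [hm]
    simpa using (ENNReal.toReal_lt_toReal ENNReal.one_ne_top hm2.ne).2 hm1
  have hP : ν.real univ < 1 := by
    have e : ν.real univ = μ.real S := by simp [Measure.real, hνapply, hS]
    have e' : Sᶜ = {s : ℝ≥0 × ℕ | s.1 < k} := by ext s; simp [hS]
    have hpos : 0 < μ.real Sᶜ := by
      rw [e']
      exact ENNReal.toReal_pos (hesc2 k hk).ne' (measure_ne_top _ _)
    rw [probReal_compl_eq_one_sub hSm] at hpos
    linarith
  have hgP : ν.real {1} ≤ ν.real univ := measureReal_mono (subset_univ _)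
  have hmg : 0 < m - g := by linarith
  have hqc0 : 0 < qc := hqc ▸ div_pos (by linarith) hmg
  have hqcm : qc * (m - g) = 1 - g := by rw [hqc, div_mul_cancel₀ _ hmg.ne']
  have hfix (q b : ℝ) : F q (1 - b) = 1 - b ↔
      b = genFun ν b + q * (ν.real univ - genFun ν b - genFun ν (1 - b)) := by
    rw [hF, hGν, genFun_zero h0, genFun_one, sub_sub_cancel]
    constructor <;> intro h <;> linarith
  have hFc (q : ℝ) : ContinuousOn (F q) (Icc 0 1) := by
    have hG' : ContinuousOn (fun x => genFun ν (1 - x)) (Icc 0 1) :=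
      continuousOn_genFun.comp (by fun_prop)
        fun x hx => ⟨by linarith [hx.2], by linarith [hx.1]⟩
    have hG0 : ContinuousOn (genFun ν) (Icc 0 1) := continuousOn_genFun
    rw [funext (hF q), hGν]
    fun_prop
  have hAmem (q : ℝ) (hq : q ∈ Ioc qc 1) :
      1 - A q ∈ Ioc (0 : ℝ) 1 ∧ F q (A q) = A q := by
    obtain ⟨b, hb, hb0⟩ := exists_fixedPoint h0 hν hP (q := q) (by
      rw [← hm', ← hg', ← hqcm]
      exact mul_lt_mul_of_pos_right hq.1 hmg)
    have hbmem : 1 - b ∈ {x ∈ Icc (0 : ℝ) 1 | F q x = x} :=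
      ⟨⟨by linarith [hb.2], by linarith [hb.1]⟩, (hfix q b).2 hb0⟩
    have hbdd : BddBelow {x ∈ Icc (0 : ℝ) 1 | F q x = x} := ⟨0, fun x hx => hx.1.1⟩
    have hclosed : IsClosed {x ∈ Icc (0 : ℝ) 1 | F q x = x} :=
      isClosed_Icc.isClosed_eq (hFc q) continuousOn_id
    have hmem := hclosed.csInf_mem ⟨_, hbmem⟩ hbdd
    have hle := csInf_le hbdd hbmem
    rw [← hA] at hmem hle
    exact ⟨⟨by linarith [hb.1], by linarith [hmem.1.1]⟩, hmem.2⟩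
  have hbound (q : ℝ) (hq : q ∈ Ioc qc 1) :
      1 - A q ≤ (q - qc) * (m - g) / (1 - ν.real univ) := by
    obtain ⟨hb, hAfix⟩ := hAmem q hq
    have h1 := fixedPoint_bound h0 hν (hqc0.trans hq.1).le hb
      ((hfix q (1 - A q)).1 (by rwa [sub_sub_cancel]))
    rw [← hm', ← hg', ← hqcm, ← sub_mul] at h1
    rw [le_div_iff₀ (by linarith), mul_comm]
    refine h1.trans (mul_le_of_le_one_right (mul_nonneg ?_ hmg.le) (by linarith [hb.1]))
    linarith [hq.1]
  have hself : ∀ᶠ q in 𝓝[Ioc qc 1] qc, q ∈ Ioc qc 1 := self_mem_nhdsWithin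
  have hlim0 : Tendsto (fun q => 1 - A q) (𝓝[Ioc qc 1] qc) (𝓝 0) := by
    have hup : Tendsto (fun q => (q - qc) * (m - g) / (1 - ν.real univ)) (𝓝[Ioc qc 1] qc)
        (𝓝 0) := by
      have hc : Continuous fun q => (q - qc) * (m - g) / (1 - ν.real univ) := by fun_prop
      simpa using (hc.tendsto qc).mono_left nhdsWithin_le_nhds
    refine tendsto_of_tendsto_of_tendsto_of_le_of_le' tendsto_const_nhds hup ?_ ?_
    · filter_upwards [hself] with q hq using (hAmem q hq).1.1.le
    · filter_upwards [hself] with q hq using hbound q hq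
  have hlim : Tendsto (fun q => 1 - A q) (𝓝[Ioc qc 1] qc) (𝓝[>] 0) :=
    tendsto_nhdsWithin_iff.2 ⟨hlim0, hself.mono fun q hq => (hAmem q hq).1.1⟩
  refine ⟨fun q hq => (hAmem q hq).1.1, ?_, ?_, ?_⟩
  · simpa using hlim0.const_sub 1
  · rw [hGν, hm', genFun_one]
    simpa [Function.comp_def] using (tendsto_sub_genFun_div hν).comp hlim
  · rw [hGν, hg']
    exact (tendsto_genFun_div h0).comp hlim
end

section
/- Let ρ_I > 0 and ρ_II ≥ 0 with ρ_I + ρ_II < 1. For each n ≥ 1 define f_n : [0,1] → [0,1] by f_n(x) = 1 − ρ_I·(1 − x^n) − ρ_II·(1 − x)^n, and let x_n be the smallest fixed point of f_n in [0,1]. Then x_n → 1 − ρ_I as n → ∞. -/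
open Set Filter Topology

/-- let `ρI > 0`, `ρII ≥ 0`, `ρI + ρII < 1`, and for `n ≥ 1` let `x n` be
the smallest fixed point in `[0,1]` of `f_n(x) = 1 − ρI(1 − xⁿ) − ρII(1 − x)ⁿ`. Then
`x n → 1 − ρI` as `n → ∞`. -/
theorem smallest_fixed_point_tendsto
    (ρI ρII : ℝ) (hI : 0 < ρI) (hII : 0 ≤ ρII) (hsum : ρI + ρII < 1)
    (x : ℕ → ℝ)
    (hx : ∀ n : ℕ, 1 ≤ n →
      IsLeast {y ∈ Set.Icc (0:ℝ) 1 |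
        1 - ρI * (1 - y ^ n) - ρII * (1 - y) ^ n = y} (x n)) :
    Tendsto x atTop (nhds (1 - ρI)) := by
  refine tendsto_order.2 ⟨fun b hb => ?_, fun b hb => ?_⟩
  · have hlim : Tendsto (fun n : ℕ => 1 - ρI - ρII * (ρI + ρII) ^ n) atTop (𝓝 (1 - ρI)) := by
      simpa using ((tendsto_pow_atTop_nhds_zero_of_lt_one (by linarith) hsum).const_mul
        ρII).const_sub (1 - ρI)
    filter_upwards [hlim.eventually_const_lt hb, eventually_ge_atTop 1] with n hn hn1
    obtain ⟨⟨⟨h0, h1⟩, hfix⟩, -⟩ := hx n hn1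
    have hpow : 0 ≤ ρI * x n ^ n := by positivity
    have hle : ρII * (1 - x n) ^ n ≤ ρII :=
      mul_le_of_le_one_right hII (pow_le_one₀ (by linarith) (by linarith))
    have hle' : ρII * (1 - x n) ^ n ≤ ρII * (ρI + ρII) ^ n :=
      mul_le_mul_of_nonneg_left (pow_le_pow_left₀ (by linarith) (by linarith) n) hII
    linarith
  · obtain ⟨c, hc, hcb⟩ := exists_between (lt_min hb (show 1 - ρI < 1 by linarith))
    obtain ⟨hcb, hc1⟩ := lt_min_iff.1 hcb
    have hc0 : 0 ≤ c := by linarith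
    have hlim : Tendsto (fun n : ℕ => 1 - ρI + ρI * c ^ n) atTop (𝓝 (1 - ρI)) := by
      simpa using ((tendsto_pow_atTop_nhds_zero_of_lt_one hc0 hc1).const_mul
        ρI).const_add (1 - ρI)
    filter_upwards [hlim.eventually_lt_const hc, eventually_ge_atTop 1] with n hn hn1
    have hcont : ContinuousOn
        (fun y : ℝ => 1 - ρI * (1 - y ^ n) - ρII * (1 - y) ^ n - y) (Icc 0 c) := by
      fun_prop
    have hpow : 0 ≤ ρII * (1 - c) ^ n := mul_nonneg hII (pow_nonneg (by linarith) n)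
    have hzero : (0 : ℝ) ^ n = 0 := zero_pow (by lia)
    obtain ⟨y, hy, hy0⟩ := intermediate_value_Icc' hc0 hcont
      (show (0 : ℝ) ∈ Icc _ _ from ⟨by linarith, by simp only [hzero, sub_zero, one_pow]; linarith⟩)
    have hmin : x n ≤ y := (hx n hn1).2 ⟨⟨hy.1, hy.2.trans hc1.le⟩, sub_eq_zero.1 hy0⟩
    linarith [hy.2]
end

section
/- Let ρ_I > 1/2 and ρ_II > 0 with ρ_I + ρ_II < 1. For each n ≥ 1 define f_n : [0,1] → [0,1] by f_n(x) = 1 − ρ_I·(1 − x^n) − ρ_II·(1 − x)^n, and let x_n be the smallest fixed point of f_n in [0,1]. Then the sequence (x_n) is eventually strictly increasing: there exists N such that x_n < x_{n+1} for all n ≥ N. -/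
open Set Filter Topology

/-- A point of `[0,1]` that a continuous function, nonnegative at `0`, does not move up bounds its
smallest fixed point in `[0,1]` from above. -/
theorem IsLeast.fixedPoint_le_of_map_le {f : ℝ → ℝ} (hf : Continuous f) (h0 : 0 ≤ f 0) {z y : ℝ}
    (hz : IsLeast {y ∈ Set.Icc (0 : ℝ) 1 | f y = y} z) (hy : y ∈ Set.Icc (0 : ℝ) 1)
    (hfy : f y ≤ y) : z ≤ y := by
  obtain ⟨w, hw, hfw⟩ := intermediate_value_Icc' hy.1 (hf.sub continuous_id).continuousOn
    (show (0 : ℝ) ∈ Set.Icc (f y - y) (f 0 - 0) from ⟨by linarith, by linarith⟩)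
  exact (hz.2 ⟨⟨hw.1, hw.2.trans hy.2⟩, sub_eq_zero.mp hfw⟩).trans hw.2

/-- let `ρI > 1/2`, `ρII > 0`, `ρI + ρII < 1`, and for `n ≥ 1` let `x n` be
the smallest fixed point in `[0,1]` of `f_n(x) = 1 − ρI(1 − xⁿ) − ρII(1 − x)ⁿ`. Then the
sequence `(x n)` is eventually strictly increasing. -/
theorem smallest_fixed_point_eventually_increasing
    (ρI ρII : ℝ) (hI : 1 / 2 < ρI) (hII : 0 < ρII) (hsum : ρI + ρII < 1)
    (x : ℕ → ℝ)
    (hx : ∀ n : ℕ, 1 ≤ n →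
      IsLeast {y ∈ Set.Icc (0:ℝ) 1 |
        1 - ρI * (1 - y ^ n) - ρII * (1 - y) ^ n = y} (x n)) :
    ∃ N : ℕ, ∀ n : ℕ, N ≤ n → x n < x (n + 1) := by
  obtain ⟨M, hM⟩ : ∃ M : ℕ, ∀ n, M ≤ n → ρI * (1 - ρI) ^ n < ρII * ρI ^ n := by
    have hlim : Tendsto (fun n : ℕ => ((1 - ρI) / ρI) ^ n) atTop (𝓝 0) :=
      tendsto_pow_atTop_nhds_zero_of_lt_one (div_nonneg (by linarith) (by linarith))
        ((div_lt_one (by linarith)).2 (by linarith))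
    obtain ⟨M, hM⟩ := eventually_atTop.1
      (hlim.eventually_lt_const (div_pos hII (by linarith : 0 < ρI)))
    refine ⟨M, fun n hn => ?_⟩
    have h := hM n hn
    rw [div_pow, div_lt_div_iff₀ (by positivity) (by linarith)] at h
    linarith
  have hle : ∀ n : ℕ, 1 ≤ n → ∀ y ∈ Set.Icc (0 : ℝ) 1,
      1 - ρI * (1 - y ^ n) - ρII * (1 - y) ^ n ≤ y → x n ≤ y := fun n hn y hy h =>
    (hx n hn).fixedPoint_le_of_map_le
      (f := fun y => 1 - ρI * (1 - y ^ n) - ρII * (1 - y) ^ n) (by fun_prop)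
      (by simp [zero_pow (by omega : n ≠ 0)]; linarith) hy h
  refine ⟨M + 1, fun n hn => ?_⟩
  obtain ⟨m, rfl⟩ : ∃ m, n = m + 1 := ⟨n - 1, by omega⟩
  obtain ⟨⟨hy0, hy1⟩, hfix⟩ := (hx (m + 1 + 1) (by omega)).1
  have hle' := hle (m + 1) (by omega) (x (m + 1 + 1)) ⟨hy0, hy1⟩
  have hc : x (m + 1 + 1) ≤ 1 - ρI := by
    refine hle (m + 1 + 1) (by omega) (1 - ρI) ⟨by linarith, by linarith⟩ ?_
    have h := hM (m + 1 + 1) (by omega)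
    rw [sub_sub_cancel]
    linarith
  have hfix' := (hx (m + 1) (by omega)).1.2
  generalize x (m + 1 + 1) = y at *
  have hpos : 0 < y := by
    refine hy0.lt_of_ne ?_
    rintro rfl
    simp at hfix
    linarith
  have hlt : ρI * y ^ m < ρII * (1 - y) ^ m := calc
    ρI * y ^ m ≤ ρI * (1 - ρI) ^ m := by gcongr
    _ < ρII * ρI ^ m := hM m (by omega)
    _ ≤ ρII * (1 - y) ^ m := by gcongr; linarith
  have hstep : 1 - ρI * (1 - y ^ (m + 1)) - ρII * (1 - y) ^ (m + 1) < y := by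
    have h := mul_pos (mul_pos hpos (by linarith : 0 < 1 - y)) (sub_pos.2 hlt)
    ring_nf at h hfix ⊢
    linarith
  refine (hle' hstep.le).lt_of_ne ?_
  intro h
  rw [h] at hfix'
  exact hstep.ne hfix'
end

section
/- Let ρ_I > 0 and ρ_II ≥ 0 with ρ_I + ρ_II < 1, and suppose that either ρ_II = 0 or ρ_I ≤ 1/2. For each n ≥ 1 define f_n : [0,1] → [0,1] by f_n(x) = 1 − ρ_I·(1 − x^n) − ρ_II·(1 − x)^n, and let x_n be the smallest fixed point of f_n in [0,1]. Then the sequence (x_n) is eventually strictly decreasing: there exists N such that x_{n+1} < x_n for all n ≥ N. -/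
open Set Filter Topology

theorem pow_succ_sub_pow_succ_le {x y : ℝ} (hx : 0 ≤ x) (hxy : x ≤ y) (n : ℕ) :
    y ^ (n + 1) - x ^ (n + 1) ≤ ((n : ℝ) + 1) * (y - x) * y ^ n := by
  induction n with
  | zero => simp
  | succ n ih =>
    have h1 := mul_le_mul_of_nonneg_left ih (hx.trans hxy)
    have h2 := mul_le_mul_of_nonneg_right (pow_le_pow_left₀ hx hxy (n + 1)) (sub_nonneg.2 hxy)
    push_cast
    calc y ^ (n + 1 + 1) - x ^ (n + 1 + 1)
        = y * (y ^ (n + 1) - x ^ (n + 1)) + x ^ (n + 1) * (y - x) := by ring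
      _ ≤ y * (((n : ℝ) + 1) * (y - x) * y ^ n) + y ^ (n + 1) * (y - x) := add_le_add h1 h2
      _ = ((n : ℝ) + 1 + 1) * (y - x) * y ^ (n + 1) := by ring

theorem tendsto_add_one_mul_const_pow_of_lt_one {r : ℝ} (h0 : 0 ≤ r) (h1 : r < 1) :
    Tendsto (fun n : ℕ => ((n : ℝ) + 1) * r ^ n) atTop (𝓝 0) := by
  simpa [add_mul] using (tendsto_self_mul_const_pow_of_lt_one h0 h1).add
    (tendsto_pow_atTop_nhds_zero_of_lt_one h0 h1)

/-- A leftmost fixed point lies strictly to the left of every point where the function is below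
the diagonal. -/
theorem isLeast_fixedPoint_lt {f : ℝ → ℝ} (hf : Continuous f) (h0 : 0 ≤ f 0) {c x : ℝ}
    (hc : c ∈ Icc (0 : ℝ) 1) (hfc : f c < c)
    (hx : IsLeast {y ∈ Icc (0 : ℝ) 1 | f y = y} x) : x < c := by
  obtain ⟨y, hy, hfy⟩ := intermediate_value_Icc' hc.1 (hf.sub continuous_id).continuousOn
    (show (0 : ℝ) ∈ Icc (f c - c) (f 0 - 0) from ⟨by linarith, by linarith⟩)
  have hfy' : f y = y := sub_eq_zero.1 hfy
  have hyc : y < c := lt_of_le_of_ne hy.2 fun h => by rw [h] at hfy'; linarith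
  exact (hx.2 ⟨⟨hy.1, hy.2.trans hc.2⟩, hfy'⟩).trans_lt hyc

theorem eventually_mul_pow_lt_mul_pow {a b : ℝ} (ha : 0 < a) (hb : 0 ≤ b) (hab : a + b < 1)
    (h : b = 0 ∨ a ≤ 1 / 2) : ∀ᶠ n : ℕ in atTop, b * a ^ n < a * (1 - a) ^ n := by
  have hq : 0 < 1 - a := by linarith
  rcases h with rfl | h
  · exact Eventually.of_forall fun n => by rw [zero_mul]; positivity
  rcases h.eq_or_lt with rfl | h
  · refine Eventually.of_forall fun n => ?_
    rw [show (1 : ℝ) - 1 / 2 = 1 / 2 by norm_num]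
    exact mul_lt_mul_of_pos_right (by linarith) (by positivity)
  · have hr : a / (1 - a) < 1 := (div_lt_one hq).2 (by linarith)
    have ht := (tendsto_pow_atTop_nhds_zero_of_lt_one (by positivity) hr).const_mul b
    rw [mul_zero] at ht
    filter_upwards [ht.eventually_lt_const ha] with n hn
    rwa [div_pow, mul_div_assoc', div_lt_iff₀ (by positivity)] at hn

/-- let `ρI > 0`, `ρII ≥ 0`, `ρI + ρII < 1`, with `ρII = 0` or `ρI ≤ 1/2`,
and for `n ≥ 1` let `x n` be the smallest fixed point in `[0,1]` of
`f_n(x) = 1 − ρI(1 − xⁿ) − ρII(1 − x)ⁿ`. Then `(x n)` is eventually strictly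
decreasing. -/
theorem smallest_fixed_point_eventually_decreasing
    (ρI ρII : ℝ) (hI : 0 < ρI) (hII : 0 ≤ ρII) (hsum : ρI + ρII < 1)
    (hcase : ρII = 0 ∨ ρI ≤ 1 / 2)
    (x : ℕ → ℝ)
    (hx : ∀ n : ℕ, 1 ≤ n →
      IsLeast {y ∈ Set.Icc (0:ℝ) 1 |
        1 - ρI * (1 - y ^ n) - ρII * (1 - y) ^ n = y} (x n)) :
    ∃ N : ℕ, ∀ n : ℕ, N ≤ n → x (n + 1) < x n := by
  set δ : ℝ := (1 - ρI - ρII) / 2 with hδ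
  have hq0 : 0 ≤ 1 - ρI := by linarith
  have hr0 : 0 ≤ 1 - δ := by linarith
  have hcont (n : ℕ) :
      Continuous fun y : ℝ => 1 - ρI * (1 - y ^ n) - ρII * (1 - y) ^ n := by fun_prop
  have hzero (n : ℕ) :
      0 ≤ 1 - ρI * (1 - (0 : ℝ) ^ (n + 1)) - ρII * (1 - 0) ^ (n + 1) := by
    simp only [ne_eq, Nat.succ_ne_zero, not_false_eq_true, zero_pow, sub_zero, one_pow]
    linarith
  have hlim1 := (tendsto_add_one_mul_const_pow_of_lt_one hq0 (by linarith)).eventually_lt_const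
    (show (0 : ℝ) < 1 by norm_num)
  have hlim2 := (tendsto_add_one_mul_const_pow_of_lt_one hr0 (by linarith)).eventually_lt_const
    (show (0 : ℝ) < 1 by norm_num)
  have hlim3 := (tendsto_pow_atTop_nhds_zero_of_lt_one
    (show 0 ≤ 1 - ρI / 2 by linarith) (by linarith)).eventually_lt_const
    (show (0 : ℝ) < 1 / 2 by norm_num)
  have hratio := eventually_mul_pow_lt_mul_pow hI hII hsum hcase
  have key : ∀ᶠ m : ℕ in atTop, x (m + 1 + 1) < x (m + 1) := by
    filter_upwards [hlim1, hlim2, (tendsto_add_atTop_nat 1).eventually hlim3, hratio,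
      (tendsto_add_atTop_nat 1).eventually hratio] with m h1 h2 h3 h4 h5
    have hleast := hx (m + 1) (by omega)
    obtain ⟨⟨hx0, hx1⟩, hfix⟩ := hleast.1
    have hlt : x (m + 1) < 1 - ρI / 2 := by
      refine isLeast_fixedPoint_lt (hcont _) (hzero m) ⟨by linarith, by linarith⟩ ?_ hleast
      have := mul_lt_mul_of_pos_left h3 hI
      have : 0 ≤ ρII * (1 - (1 - ρI / 2)) ^ (m + 1) :=
        mul_nonneg hII (pow_nonneg (by linarith) _)
      linarith
    have hnext := hx (m + 1 + 1) (by omega)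
    generalize x (m + 1) = z at *
    have hge : 1 - ρI ≤ z := by
      by_contra! hz
      have hpow : 0 ≤ z ^ (m + 1) := pow_nonneg hx0 _
      have hδz : δ ≤ z := by
        by_contra! hzδ
        have := mul_nonneg hI.le hpow
        have := mul_le_of_le_one_right hII
          (pow_le_one₀ (n := m + 1) (show 0 ≤ 1 - z by linarith) (by linarith))
        linarith
      have hA := pow_succ_sub_pow_succ_le hx0 hz.le m
      have hB := pow_succ_sub_pow_succ_le hI.le (show ρI ≤ 1 - z by linarith) m
      have hC : (1 - z) ^ m ≤ (1 - δ) ^ m := pow_le_pow_left₀ (by linarith) (by linarith) m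
      have hC' : ((m : ℝ) + 1) * (1 - z) ^ m ≤ 1 :=
        (mul_le_mul_of_nonneg_left hC (by positivity)).trans h2.le
      have ht : 0 < 1 - ρI - z := by linarith
      have hA' : (1 - ρI) ^ (m + 1) - z ^ (m + 1) ≤ 1 - ρI - z := by
        nlinarith
      have hB' : (1 - z) ^ (m + 1) - ρI ^ (m + 1) ≤ 1 - ρI - z := by
        nlinarith
      have hA'' := mul_le_mul_of_nonneg_left hA' hI.le
      have hB'' := mul_le_mul_of_nonneg_left hB' hII
      have := mul_pos (sub_pos.2 hsum) ht
      linarith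
    refine isLeast_fixedPoint_lt (hcont _) (hzero _) ⟨hx0, hx1⟩ ?_ hnext
    have hD : ρII * (1 - z) ^ m < ρI * z ^ m :=
      calc ρII * (1 - z) ^ m ≤ ρII * ρI ^ m :=
            mul_le_mul_of_nonneg_left (pow_le_pow_left₀ (by linarith) (by linarith) m) hII
        _ < ρI * (1 - ρI) ^ m := h4
        _ ≤ ρI * z ^ m := mul_le_mul_of_nonneg_left (pow_le_pow_left₀ hq0 hge m) hI.le
    have hpos : 0 < z * (1 - z) := mul_pos (by linarith) (by linarith)
    have hE := mul_lt_mul_of_pos_right hD hpos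
    refine lt_of_lt_of_eq ?_ hfix
    rw [← sub_pos] at hE ⊢
    refine hE.trans_eq ?_
    ring
  obtain ⟨M, hM⟩ := eventually_atTop.1 key
  refine ⟨M + 1, fun n hn => ?_⟩
  obtain ⟨k, rfl⟩ := Nat.exists_eq_add_of_le hn
  have := hM (M + k) (by omega)
  rwa [show M + 1 + k = M + k + 1 by omega]
end

section
/- Let k > 0 and let p be a Borel probability measure on S with p({γ < k}) > 0. Define the avoidance vgf f′_k : [0,1] → ℝ by f′_k(x) = 1 − G_I(k,0) − G_I(k,1) + G_I(k,x) − (p_II(k,0) + p_II(k,1)·(1−x)). Then f_k has a fixed point in [0,1) if and only if f′_k has a fixed point in [0,1). -/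
open MeasureTheory Set Filter Topology
open scoped ENNReal NNReal

/-- The space `S = {I,II} × [0,∞) × ℕ`; `true` stands for Player I,
`false` for Player II. -/
abbrev GameS : Type := Bool × ℝ≥0 × ℕ

/-- `pk p i k n = p({ι = i} ∩ {γ ≥ k} ∩ {ξ = n})`. -/
noncomputable def pk (p : Measure GameS) (i : Bool) (k : ℝ≥0) (n : ℕ) : ℝ :=
  (p {s : GameS | s.1 = i ∧ k ≤ s.2.1 ∧ s.2.2 = n}).toReal

/-- The generating function `G_i(k,x) = Σ_n p_i(k,n) xⁿ`. -/
noncomputable def Gk (p : Measure GameS) (i : Bool) (k : ℝ≥0) (x : ℝ) : ℝ :=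
  ∑' n : ℕ, pk p i k n * x ^ n

/-- The value generating function
`f(k,x) = 1 − G_I(k,0) − G_I(k,1) + G_I(k,x) − G_II(k,1−x)`. -/
noncomputable def vgf (p : Measure GameS) (k : ℝ≥0) (x : ℝ) : ℝ :=
  1 - Gk p true k 0 - Gk p true k 1 + Gk p true k x - Gk p false k (1 - x)


/-- The generating function `Σ_n c_n xⁿ` of a real sequence. -/
noncomputable def powerSum (c : ℕ → ℝ) (x : ℝ) : ℝ := ∑' n, c n * x ^ n

lemma ConvexOn.tsum {s : Set ℝ} {f : ℕ → ℝ → ℝ} (hs : Convex ℝ s)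
    (hf : ∀ n, ConvexOn ℝ s (f n)) (hsum : ∀ x ∈ s, Summable fun n => f n x) :
    ConvexOn ℝ s fun x => ∑' n, f n x := by
  refine ⟨hs, fun x hx y hy u v hu hv huv => ?_⟩
  simp only [smul_eq_mul]
  rw [← tsum_mul_left, ← tsum_mul_left,
    ← ((hsum x hx).mul_left u).tsum_add ((hsum y hy).mul_left v)]
  exact (hsum _ (hs hx hy hu hv huv)).tsum_le_tsum
    (fun n => (hf n).2 hx hy hu hv huv)
    (((hsum x hx).mul_left u).add ((hsum y hy).mul_left v))

section PowerSum

variable {c : ℕ → ℝ}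

lemma summable_mul_pow (hc : ∀ n, 0 ≤ c n) (hs : Summable c) {x : ℝ}
    (hx : x ∈ Icc (0 : ℝ) 1) : Summable fun n => c n * x ^ n :=
  hs.of_nonneg_of_le (fun n => mul_nonneg (hc n) (pow_nonneg hx.1 n))
    fun n => mul_le_of_le_one_right (hc n) (pow_le_one₀ hx.1 hx.2)

lemma powerSum_zero : powerSum c 0 = c 0 := by
  rw [powerSum, tsum_eq_single 0 (fun n hn => by simp [hn])]
  simp

lemma powerSum_one : powerSum c 1 = ∑' n, c n := by
  simp [powerSum]

lemma continuousOn_powerSum (hc : ∀ n, 0 ≤ c n) (hs : Summable c) :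
    ContinuousOn (powerSum c) (Icc 0 1) := by
  refine continuousOn_tsum (fun n => by fun_prop) hs fun n x hx => ?_
  rw [Real.norm_of_nonneg (mul_nonneg (hc n) (pow_nonneg hx.1 n))]
  exact mul_le_of_le_one_right (hc n) (pow_le_one₀ hx.1 hx.2)

lemma affine_le_powerSum (hc : ∀ n, 0 ≤ c n) (hs : Summable c) {x : ℝ}
    (hx : x ∈ Icc (0 : ℝ) 1) : c 0 + c 1 * x ≤ powerSum c x := by
  have := (summable_mul_pow hc hs hx).sum_le_tsum (Finset.range 2)
    fun n _ => mul_nonneg (hc n) (pow_nonneg hx.1 n)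
  simpa [powerSum, Finset.sum_range_succ] using this

lemma powerSum_eq_add_mul (hc : ∀ n, 0 ≤ c n) (hs : Summable c) {x : ℝ}
    (hx : x ∈ Icc (0 : ℝ) 1) :
    powerSum c x = c 0 + x * powerSum (fun n => c (n + 1)) x := by
  rw [powerSum, (summable_mul_pow hc hs hx).tsum_eq_zero_add, powerSum, ← tsum_mul_left]
  simp only [pow_zero, mul_one]
  congr 2 with n
  ring

lemma powerSum_le_tsum (hc : ∀ n, 0 ≤ c n) (hs : Summable c) {x : ℝ}
    (hx : x ∈ Icc (0 : ℝ) 1) : powerSum c x ≤ ∑' n, c n :=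
  (summable_mul_pow hc hs hx).tsum_le_tsum
    (fun n => mul_le_of_le_one_right (hc n) (pow_le_one₀ hx.1 hx.2)) hs

lemma powerSum_le_affine_add_sq (hc : ∀ n, 0 ≤ c n) (hs : Summable c)
    (hle : ∑' n, c n ≤ 1) {x : ℝ} (hx : x ∈ Icc (0 : ℝ) 1) :
    powerSum c x ≤ c 0 + c 1 * x + x ^ 2 := by
  have hs₁ : Summable fun n => c (n + 1) := (summable_nat_add_iff 1).2 hs
  have hs₂ : Summable fun n => c (n + 1 + 1) := (summable_nat_add_iff 2).2 hs
  rw [powerSum_eq_add_mul hc hs hx, powerSum_eq_add_mul (fun n => hc (n + 1)) hs₁ hx]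
  have hbound := powerSum_le_tsum (fun n => hc (n + 1 + 1)) hs₂ hx
  have hsplit := hs.tsum_eq_zero_add
  have hsplit' := hs₁.tsum_eq_zero_add
  have : powerSum (fun n => c (n + 1 + 1)) x ≤ 1 := by
    have := hc 0
    have := hc (0 + 1)
    linarith
  have := mul_le_mul_of_nonneg_left this (sq_nonneg x)
  simp only [zero_add]
  nlinarith

lemma convexOn_powerSum_one_sub (hc : ∀ n, 0 ≤ c n) (hs : Summable c) :
    ConvexOn ℝ (Ico 0 1) fun x => powerSum c (1 - x) := by
  refine ConvexOn.tsum (convex_Ico 0 1) (fun n => ?_) fun x hx =>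
    summable_mul_pow hc hs ⟨by linarith [hx.2], by linarith [hx.1]⟩
  refine ⟨convex_Ico 0 1, fun x hx y hy u v hu hv huv => ?_⟩
  have h := (convexOn_pow n).2 (x := 1 - x) (by simpa using hx.2.le) (y := 1 - y)
    (by simpa using hy.2.le) hu hv huv
  simp only [smul_eq_mul] at h ⊢
  have heq : 1 - (u * x + v * y) = u * (1 - x) + v * (1 - y) := by linear_combination -huv
  rw [heq]
  have := mul_le_mul_of_nonneg_left h (hc n)
  linarith

lemma hasSum_mul_geom_sum (hc : ∀ n, 0 ≤ c n) (hs : Summable c) {x : ℝ}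
    (hx : x ∈ Ico (0 : ℝ) 1) :
    HasSum (fun n => c n * ∑ j ∈ Finset.range n, x ^ j)
      ((1 - x)⁻¹ * (∑' n, c n - powerSum c x)) := by
  have h := (hs.hasSum.sub
    (summable_mul_pow hc hs ⟨hx.1, hx.2.le⟩).hasSum).mul_left (1 - x)⁻¹
  have hne : 1 - x ≠ 0 := by linarith [hx.2]
  have heq : (fun n => c n * ∑ j ∈ Finset.range n, x ^ j) =
      fun n => (1 - x)⁻¹ * (c n - c n * x ^ n) := by
    funext n
    rw [← mul_one_sub, ← mul_neg_geom_sum x n]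
    field_simp
  rw [heq]
  exact h

lemma convexOn_powerSum_quotient (hc : ∀ n, 0 ≤ c n) (hs : Summable c) :
    ConvexOn ℝ (Ico 0 1) fun x => (1 - x)⁻¹ * (∑' n, c n - powerSum c x) := by
  have h : ConvexOn ℝ (Ico 0 1) fun x =>
      ∑' n, c n * ∑ j ∈ Finset.range n, x ^ j := by
    refine ConvexOn.tsum (convex_Ico 0 1) (fun n => ?_) fun x hx =>
      (hasSum_mul_geom_sum hc hs hx).summable
    refine ConvexOn.smul (hc n) ⟨convex_Ico 0 1, fun x hx y hy u v hu hv huv => ?_⟩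
    simp only [smul_eq_mul, Finset.mul_sum, ← Finset.sum_add_distrib]
    exact Finset.sum_le_sum fun j _ => (convexOn_pow j).2 hx.1 hy.1 hu hv huv
  exact h.congr fun x hx => (hasSum_mul_geom_sum hc hs hx).tsum_eq

end PowerSum

lemma exists_fixedPoint_of_le {f : ℝ → ℝ} (hf : ContinuousOn f (Icc 0 1)) (h₀ : 0 < f 0)
    {x : ℝ} (hx : x ∈ Ico (0 : ℝ) 1) (hle : f x ≤ x) : ∃ y ∈ Ico (0 : ℝ) 1, f y = y := by
  have hcont : ContinuousOn (fun y => f y - y) (Icc 0 x) :=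
    (hf.mono (Icc_subset_Icc_right hx.2.le)).sub continuousOn_id
  obtain ⟨y, hy, hfy⟩ := intermediate_value_Icc' hx.1 hcont
    (show (0 : ℝ) ∈ Icc (f x - x) (f 0 - 0) from ⟨by linarith, by linarith⟩)
  exact ⟨y, ⟨hy.1, hy.2.trans_lt hx.2⟩, by simpa [sub_eq_zero] using hfy⟩

lemma exists_fixedPoint_of_lt_one {f : ℝ → ℝ} (hf : ContinuousOn f (Icc 0 1)) (h₀ : 0 < f 0)
    (h₁ : f 1 < 1) : ∃ y ∈ Ico (0 : ℝ) 1, f y = y := by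
  have hcont : ContinuousOn (fun y => f y - y) (Icc 0 1) := hf.sub continuousOn_id
  obtain ⟨y, hy, hfy⟩ := intermediate_value_Icc' zero_le_one hcont
    (show (0 : ℝ) ∈ Icc (f 1 - 1) (f 0 - 0) from ⟨by linarith, by linarith⟩)
  have hfy' : f y = y := by simpa [sub_eq_zero] using hfy
  refine ⟨y, ⟨hy.1, lt_of_le_of_ne hy.2 ?_⟩, hfy'⟩
  rintro rfl
  linarith

/-- A concave function on `[0,1)` that is positive at `0` and vanishes at some point of `[0,1)`
is below `-(1 - x)` for some `x` close to `1`. -/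
lemma ConcaveOn.exists_add_one_sub_neg {q : ℝ → ℝ} (hq : ConcaveOn ℝ (Ico 0 1) q)
    (h₀ : 0 < q 0) {z : ℝ} (hz : z ∈ Ico (0 : ℝ) 1) (hqz : q z = 0) :
    ∃ x ∈ Ico (0 : ℝ) 1, q x + (1 - x) < 0 := by
  have hz₀ : 0 < z := lt_of_le_of_ne hz.1 (by rintro rfl; linarith)
  have hz₁ : 0 < 1 - z := by linarith [hz.2]
  obtain ⟨y, hy⟩ : ∃ y, y = q 0 * (1 - z) / (2 * (z + q 0)) := ⟨_, rfl⟩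
  have hy₀ : 0 < y := by rw [hy]; positivity
  have hymul : y * (2 * (z + q 0)) = q 0 * (1 - z) := by rw [hy]; field_simp
  have hy₁ : y < 1 - z := by nlinarith [mul_pos hz₁ hz₀, mul_pos hz₁ h₀]
  have hx₀ : 0 < 1 - y := by linarith
  have hx : 1 - y ∈ Ico (0 : ℝ) 1 := ⟨hx₀.le, by linarith⟩
  refine ⟨1 - y, hx, ?_⟩
  have h := hq.2 (show (0 : ℝ) ∈ Ico (0 : ℝ) 1 by simp) hx
    (show 0 ≤ (1 - y - z) / (1 - y) from div_nonneg (by linarith) hx₀.le)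
    (show 0 ≤ z / (1 - y) from div_nonneg hz.1 hx₀.le) (by field_simp; ring)
  have heq : ((1 - y - z) / (1 - y)) • (0 : ℝ) + (z / (1 - y)) • (1 - y) = z := by
    simp only [smul_eq_mul]; field_simp; ring
  rw [heq, hqz, smul_eq_mul, smul_eq_mul, div_mul_eq_mul_div, div_mul_eq_mul_div, ← add_div,
    div_le_iff₀ hx₀, zero_mul] at h
  by_contra! hcon
  nlinarith [mul_le_mul_of_nonneg_left hcon hz.1, mul_pos hy₀ hz₀, mul_pos hy₀ h₀]

theorem fixedPoint_iff_of_sequences {a b : ℕ → ℝ} (ha : ∀ n, 0 ≤ a n) (hb : ∀ n, 0 ≤ b n)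
    (hsa : Summable a) (hsb : Summable b) (hlt : ∑' n, a n + ∑' n, b n < 1) :
    (∃ x ∈ Ico (0 : ℝ) 1,
      1 - a 0 - ∑' n, a n + powerSum a x - powerSum b (1 - x) = x) ↔
    (∃ x ∈ Ico (0 : ℝ) 1,
      1 - a 0 - ∑' n, a n + powerSum a x - (b 0 + b 1 * (1 - x)) = x) := by
  have hcont_a := continuousOn_powerSum ha hsa
  have hmaps : MapsTo (fun x : ℝ => 1 - x) (Icc 0 1) (Icc 0 1) := fun x hx =>
    ⟨by linarith [hx.2], by linarith [hx.1]⟩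
  have hcont_b : ContinuousOn (fun x => powerSum b (1 - x)) (Icc 0 1) :=
    (continuousOn_powerSum hb hsb).comp (by fun_prop) hmaps
  have hcont : ContinuousOn (fun x => 1 - a 0 - ∑' n, a n + powerSum a x - powerSum b (1 - x))
      (Icc 0 1) := by fun_prop
  have hcont' : ContinuousOn
      (fun x => 1 - a 0 - ∑' n, a n + powerSum a x - (b 0 + b 1 * (1 - x))) (Icc 0 1) := by
    fun_prop
  have hle : ∀ x ∈ Icc (0 : ℝ) 1, b 0 + b 1 * (1 - x) ≤ powerSum b (1 - x) := fun x hx =>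
    affine_le_powerSum hb hsb (hmaps hx)
  have hpos : 0 < 1 - a 0 - ∑' n, a n + powerSum a 0 - powerSum b (1 - 0) := by
    rw [sub_zero, powerSum_zero, powerSum_one]; linarith
  have hpos' : 0 < 1 - a 0 - ∑' n, a n + powerSum a 0 - (b 0 + b 1 * (1 - 0)) := by
    linarith [hle 0 (by simp)]
  refine ⟨?_, fun ⟨x, hx, hfx⟩ => exists_fixedPoint_of_le hcont hpos hx
    (by linarith [hle x ⟨hx.1, hx.2.le⟩])⟩
  rintro ⟨z, hz, hfz⟩
  rcases (add_nonneg (ha 0) (hb 0)).lt_or_eq with h₀ | h₀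
  · refine exists_fixedPoint_of_lt_one hcont' hpos' ?_
    rw [powerSum_one]
    linarith
  have ha₀ : a 0 = 0 := by linarith [ha 0, hb 0]
  have hb₀ : b 0 = 0 := by linarith [ha 0, hb 0]
  have hsb₁ : Summable fun n => b (n + 1) := (summable_nat_add_iff 1).2 hsb
  let q : ℝ → ℝ := fun x => 1 - ((1 - x)⁻¹ * (∑' n, a n - powerSum a x) +
    powerSum (fun n => b (n + 1)) (1 - x))
  have hq : ConcaveOn ℝ (Ico 0 1) q :=
    (concaveOn_const 1 (convex_Ico 0 1)).sub
      ((convexOn_powerSum_quotient ha hsa).add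
        (convexOn_powerSum_one_sub (fun n => hb (n + 1)) hsb₁))
  have hfac : ∀ x ∈ Ico (0 : ℝ) 1, (1 - x) * q x =
      1 - a 0 - ∑' n, a n + powerSum a x - powerSum b (1 - x) - x := by
    intro x hx
    have hne : 1 - x ≠ 0 := by linarith [hx.2]
    rw [powerSum_eq_add_mul hb hsb (hmaps ⟨hx.1, hx.2.le⟩), ha₀, hb₀]
    simp only [q]
    field_simp
    ring
  have hq₀ : 0 < q 0 := by
    have := hfac 0 (by simp)
    linarith
  have hqz : q z = 0 := by
    have hne : 1 - z ≠ 0 := by linarith [hz.2]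
    have := hfac z hz
    exact (mul_eq_zero.1 (by linarith : (1 - z) * q z = 0)).resolve_left hne
  obtain ⟨x, hx, hqx⟩ := hq.exists_add_one_sub_neg hq₀ hz hqz
  refine exists_fixedPoint_of_le hcont' hpos' hx ?_
  have hble : ∑' n, b n ≤ 1 := by
    have : 0 ≤ ∑' n, a n := tsum_nonneg ha
    linarith
  have hup := powerSum_le_affine_add_sq hb hsb hble (hmaps ⟨hx.1, hx.2.le⟩)
  have := hfac x hx
  have := mul_neg_of_pos_of_neg (by linarith [hx.2] : 0 < 1 - x) hqx
  simp only at hup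
  nlinarith

lemma hasSum_pk (p : Measure GameS) [IsProbabilityMeasure p] (i : Bool) (k : ℝ≥0) :
    HasSum (pk p i k) (p.real {s : GameS | s.1 = i ∧ k ≤ s.2.1}) := by
  have hmeas : ∀ n, MeasurableSet {s : GameS | s.1 = i ∧ k ≤ s.2.1 ∧ s.2.2 = n} := fun n => by
    measurability
  have hdisj : Pairwise (Function.onFun Disjoint
      fun n => {s : GameS | s.1 = i ∧ k ≤ s.2.1 ∧ s.2.2 = n}) := fun m n hmn =>
    Set.disjoint_left.2 fun s hs ht => hmn (hs.2.2.symm.trans ht.2.2)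
  have hunion : {s : GameS | s.1 = i ∧ k ≤ s.2.1} =
      ⋃ n, {s : GameS | s.1 = i ∧ k ≤ s.2.1 ∧ s.2.2 = n} := by
    ext s; simp
  have h := measure_iUnion (μ := p) hdisj hmeas
  have hne : ∑' n, p {s : GameS | s.1 = i ∧ k ≤ s.2.1 ∧ s.2.2 = n} ≠ ∞ :=
    h ▸ measure_ne_top p _
  rw [Measure.real, hunion, h, ENNReal.tsum_toReal_eq (ENNReal.ne_top_of_tsum_ne_top hne)]
  exact (ENNReal.summable_toReal hne).hasSum

lemma tsum_pk_add_tsum_pk_lt_one (p : Measure GameS) [IsProbabilityMeasure p] {k : ℝ≥0}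
    (h : 0 < p {s : GameS | s.2.1 < k}) :
    ∑' n, pk p true k n + ∑' n, pk p false k n < 1 := by
  rw [(hasSum_pk p true k).tsum_eq, (hasSum_pk p false k).tsum_eq,
    ← measureReal_union
      (Set.disjoint_left.2 fun s hs ht => Bool.noConfusion (hs.1.symm.trans ht.1))
      (by measurability)]
  have hmeas : MeasurableSet {s : GameS | s.2.1 < k} := by measurability
  have hunion : {s : GameS | s.1 = true ∧ k ≤ s.2.1} ∪ {s : GameS | s.1 = false ∧ k ≤ s.2.1} =
      {s : GameS | s.2.1 < k}ᶜ := by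
    ext ⟨i, r, n⟩
    cases i <;> simp
  rw [hunion, probReal_compl_eq_one_sub hmeas]
  have : 0 < p.real {s : GameS | s.2.1 < k} := ENNReal.toReal_pos h.ne' (measure_ne_top p _)
  linarith

/-- let `k > 0` and `p({γ < k}) > 0`, and let
`f′_k(x) = 1 − G_I(k,0) − G_I(k,1) + G_I(k,x) − (p_II(k,0) + p_II(k,1)(1−x))` be the vgf
of the avoidance game. Then `f_k` has a fixed point in `[0,1)` if and only if `f′_k`
does. -/
theorem vgf_fixed_point_iff_avoidance
    (p : Measure GameS) [IsProbabilityMeasure p] (k : ℝ≥0) (hk : 0 < k)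
    (h : 0 < p {s : GameS | s.2.1 < k}) :
    (∃ x ∈ Set.Ico (0:ℝ) 1, vgf p k x = x) ↔
    (∃ x ∈ Set.Ico (0:ℝ) 1,
      1 - Gk p true k 0 - Gk p true k 1 + Gk p true k x
        - (pk p false k 0 + pk p false k 1 * (1 - x)) = x) := by
  have hGk : ∀ i x, Gk p i k x = powerSum (pk p i k) x := fun _ _ => rfl
  simp only [vgf, hGk, powerSum_zero, powerSum_one]
  exact fixedPoint_iff_of_sequences (fun _ => ENNReal.toReal_nonneg)
    (fun _ => ENNReal.toReal_nonneg) (hasSum_pk p true k).summable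
    (hasSum_pk p false k).summable (tsum_pk_add_tsum_pk_lt_one p h)
end

section
/- Let 0 ≤ α < 1 and β = 1 − α. Let (a_m)_{m∈ℕ} be non-negative reals with Σ_{m∈ℕ} a_m ≤ 1, and set A(y) = Σ_{m∈ℕ} a_m·y^m for y ∈ [0,1]. Define b_0 = a_0/β and, for n ≥ 1, b_n = Σ_{m ≥ n} a_m·C(m,n)·β^{n−1}·α^{m−n} (where C(m,n) is the binomial coefficient). Then for every x ∈ [0,1], Σ_{n∈ℕ} b_n·x^n = (A(α + β·x) + A(0) − A(α))/β. -/
open Set Filter Topology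

/-- A non-negative family on `ℕ × ℕ` sums to `S` as soon as its antidiagonal sums do. -/
theorem hasSum_prod_of_hasSum_antidiagonal {f : ℕ × ℕ → ℝ} (hf : ∀ p, 0 ≤ f p) {S : ℝ}
    (h : HasSum (fun m => ∑ p ∈ Finset.HasAntidiagonal.antidiagonal m, f p) S) : HasSum f S := by
  have fiber : ∀ m, HasSum (fun p : Finset.HasAntidiagonal.antidiagonal m => f p)
      (∑ p ∈ Finset.HasAntidiagonal.antidiagonal m, f p) := fun m => Finset.hasSum _ f
  rw [← Finset.HasAntidiagonal.sigmaAntidiagonalEquivProd.hasSum_iff]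
  have hs : Summable (f ∘ Finset.HasAntidiagonal.sigmaAntidiagonalEquivProd (A := ℕ)) := by
    refine (summable_sigma_of_nonneg fun _ => hf _).2 ⟨fun m => (fiber m).summable, ?_⟩
    exact h.summable.congr fun m => (fiber m).tsum_eq.symm
  exact (hs.hasSum.sigma fiber).unique h ▸ hs.hasSum

/-- Expanding a power series with non-negative coefficients at a sum `u + v`. -/
theorem hasSum_choose_mul_pow_mul_pow {a : ℕ → ℝ} (ha : ∀ m, 0 ≤ a m) {u v S : ℝ}
    (hu : 0 ≤ u) (hv : 0 ≤ v) (h : HasSum (fun m => a m * (u + v) ^ m) S) :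
    HasSum (fun p : ℕ × ℕ =>
      a (p.1 + p.2) * ((p.1 + p.2).choose p.1 : ℝ) * u ^ p.1 * v ^ p.2) S := by
  refine hasSum_prod_of_hasSum_antidiagonal
    (fun p => by have := ha (p.1 + p.2); positivity) ?_
  convert h using 2 with m
  rw [(Commute.all u v).add_pow', Finset.mul_sum]
  refine Finset.sum_congr rfl fun p hp => ?_
  rw [Finset.HasAntidiagonal.mem_antidiagonal.1 hp, nsmul_eq_mul]
  ring

/-- let `0 ≤ α < 1`, `β = 1 − α`, and `(a_m)` non-negative and summable
with `Σ a_m ≤ 1`; set `A(y) = Σ a_m yᵐ`. With `b_0 = a_0/β` and, for `n ≥ 1`,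
`b_n = Σ_{m ≥ n} a_m C(m,n) β^{n−1} α^{m−n}` (reindexed via `m = n + j`), one has, for
every `x ∈ [0,1]`, that `Σ b_n xⁿ` converges and equals `(A(α + βx) + A(0) − A(α))/β`. -/
theorem conditional_generating_function_identity
    (α : ℝ) (hα0 : 0 ≤ α) (hα1 : α < 1) (β : ℝ) (hβ : β = 1 - α)
    (a : ℕ → ℝ) (ha : ∀ m, 0 ≤ a m) (hsa : Summable a) (hle : ∑' m, a m ≤ 1)
    (A : ℝ → ℝ) (hA : ∀ y : ℝ, A y = ∑' m : ℕ, a m * y ^ m)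
    (b : ℕ → ℝ) (hb0 : b 0 = a 0 / β)
    (hbn : ∀ n : ℕ, 1 ≤ n →
      b n = ∑' j : ℕ, a (n + j) * ((n + j).choose n : ℝ) * β ^ (n - 1) * α ^ j) :
    ∀ x ∈ Set.Icc (0:ℝ) 1,
      Summable (fun n : ℕ => b n * x ^ n) ∧
      ∑' n : ℕ, b n * x ^ n = (A (α + β * x) + A 0 - A α) / β := by
  rintro x ⟨hx0, hx1⟩
  have hβ0 : 0 < β := by linarith
  have hβx : 0 ≤ β * x := by positivity
  have hy1 : β * x + α ≤ 1 := by nlinarith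
  have hS : HasSum (fun m => a m * (β * x + α) ^ m) (A (α + β * x)) := by
    rw [hA, add_comm α]
    refine (Summable.of_nonneg_of_le (fun m => ?_) (fun m => ?_) hsa).hasSum
    · have := ha m
      positivity
    · exact mul_le_of_le_one_right (ha m) (pow_le_one₀ (by positivity) hy1)
  have hprod := hasSum_choose_mul_pow_mul_pow ha hβx hα0 hS
  have hF := hprod.prod_fiberwise fun n => (hprod.summable.prod_factor n).hasSum
  have hA0 : A 0 = a 0 := by
    rw [hA, tsum_eq_single 0 fun m hm => by simp [hm]]
    simp
  have hsum : HasSum (fun n => b n * x ^ n) ((A (α + β * x) + (A 0 - A α)) / β) := by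
    refine ((hF.add (hasSum_ite_eq 0 (A 0 - A α))).div_const β).congr_fun ?_
    intro n
    rcases n with _ | n
    · simp [hb0, hA0, hA α]
    · rw [hbn (n + 1) (by omega), ← tsum_mul_right, if_neg (by omega), add_zero,
        ← tsum_div_const]
      refine tsum_congr fun j => ?_
      rw [Nat.add_sub_cancel]
      rw [mul_pow, pow_succ β n]
      field_simp
  rw [add_sub_assoc]
  exact ⟨hsum.summable, hsum.tsum_eq⟩
end

section
/- Let 0 ≤ α < 1 and β = 1 − α. Let (a_m)_{m∈ℕ} and (a′_m)_{m∈ℕ} be non-negative reals with Σ_{m∈ℕ} (a_m + a′_m) ≤ 1. Set A(y) = Σ_m a_m·y^m, A′(y) = Σ_m a′_m·y^m for y ∈ [0,1], and f(y) = 1 − A(0) − A(1) + A(y) − A′(1−y). Define b_0 = a_0/β and b_n = Σ_{m ≥ n} a_m·C(m,n)·β^{n−1}·α^{m−n} for n ≥ 1; define b′_0 = a′_0/β and b′_n = a′_n·β^{n−1} for n ≥ 1. Set B(x) = Σ_n b_n·x^n, B′(x) = Σ_n b′_n·x^n, and f*(x) = 1 − B(0) − B(1) + B(x) − B′(1−x).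 Then f*(x) = (f(β·x + α) − α)/β for every x ∈ [0,1]. -/
open Set Filter Topology

/-- Binomial re-expansion of a power series with non-negative summable coefficients. -/
theorem hasSum_binomial_expansion {a : ℕ → ℝ} (ha : ∀ m, 0 ≤ a m) (hsa : Summable a)
    {u v : ℝ} (hu : 0 ≤ u) (hv : 0 ≤ v) (huv : u + v ≤ 1) :
    HasSum (fun n : ℕ => (∑' j : ℕ, a (n + j) * ((n + j).choose n : ℝ) * v ^ j) * u ^ n)
      (∑' m : ℕ, a m * (u + v) ^ m) := by
  set F : ℕ × ℕ → ℝ := fun p =>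
    a (p.1 + p.2) * ((p.1 + p.2).choose p.1 : ℝ) * v ^ p.2 * u ^ p.1 with hF
  have hF0 : ∀ p, 0 ≤ F p := fun p => by
    have := ha (p.1 + p.2)
    positivity
  have hfiber : ∀ m : ℕ,
      ∑ p ∈ Finset.HasAntidiagonal.antidiagonal m, F p = a m * (u + v) ^ m := fun m => by
    rw [(Commute.all u v).add_pow', Finset.mul_sum]
    refine Finset.sum_congr rfl fun p hp => ?_
    rw [Finset.HasAntidiagonal.mem_antidiagonal] at hp
    simp only [hF, hp, nsmul_eq_mul]
    ring
  have hsm : Summable fun m : ℕ => a m * (u + v) ^ m :=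
    hsa.of_nonneg_of_le (fun m => mul_nonneg (ha m) (by positivity))
      fun m => mul_le_of_le_one_right (ha m) (pow_le_one₀ (by positivity) huv)
  have hinner : ∀ m : ℕ,
      HasSum (fun p : Finset.HasAntidiagonal.antidiagonal m => F p) (a m * (u + v) ^ m) := fun m => by
    rw [← hfiber m, ← Finset.sum_coe_sort]
    exact hasSum_fintype _
  have hsigma : Summable (F ∘ Finset.HasAntidiagonal.sigmaAntidiagonalEquivProd (A := ℕ)) := by
    refine (summable_sigma_of_nonneg fun p => hF0 _).2 ⟨fun m => (hinner m).summable, ?_⟩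
    exact hsm.congr fun m => (hinner m).tsum_eq.symm
  have hsF : Summable F := (Equiv.summable_iff _).1 hsigma
  have htotal : ∑' p, F p = ∑' m : ℕ, a m * (u + v) ^ m := by
    rw [← (Finset.HasAntidiagonal.sigmaAntidiagonalEquivProd (A := ℕ)).tsum_eq F]
    exact (hsigma.hasSum.sigma hinner).tsum_eq.symm
  rw [← htotal]
  simpa only [hF, tsum_mul_right] using
    hsF.hasSum.prod_fiberwise fun n => (hsF.prod_factor n).hasSum

/-- let `0 ≤ α < 1`, `β = 1 − α`, and `(a_m)`, `(a′_m)` non-negative and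
summable with `Σ (a_m + a′_m) ≤ 1`. Set `A(y) = Σ a_m yᵐ`, `A′(y) = Σ a′_m yᵐ` and
`f(y) = 1 − A(0) − A(1) + A(y) − A′(1−y)`. Define `b_0 = a_0/β`,
`b_n = Σ_{m ≥ n} a_m C(m,n) β^{n−1} α^{m−n}` (reindexed via `m = n + j`) for `n ≥ 1`,
`b′_0 = a′_0/β`, `b′_n = a′_n β^{n−1}` for `n ≥ 1`, and set `B(x) = Σ b_n xⁿ`,
`B′(x) = Σ b′_n xⁿ`, `f*(x) = 1 − B(0) − B(1) + B(x) − B′(1−x)`. Then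
`f*(x) = (f(βx + α) − α)/β` for every `x ∈ [0,1]`. -/
theorem conditional_vgf_identity
    (α : ℝ) (hα0 : 0 ≤ α) (hα1 : α < 1) (β : ℝ) (hβ : β = 1 - α)
    (a a' : ℕ → ℝ) (ha : ∀ m, 0 ≤ a m) (ha' : ∀ m, 0 ≤ a' m)
    (hsa : Summable a) (hsa' : Summable a')
    (hle : ∑' m : ℕ, (a m + a' m) ≤ 1)
    (A A' : ℝ → ℝ)
    (hA : ∀ y : ℝ, A y = ∑' m : ℕ, a m * y ^ m)
    (hA' : ∀ y : ℝ, A' y = ∑' m : ℕ, a' m * y ^ m)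
    (f : ℝ → ℝ) (hf : ∀ y : ℝ, f y = 1 - A 0 - A 1 + A y - A' (1 - y))
    (b b' : ℕ → ℝ)
    (hb0 : b 0 = a 0 / β)
    (hbn : ∀ n : ℕ, 1 ≤ n →
      b n = ∑' j : ℕ, a (n + j) * ((n + j).choose n : ℝ) * β ^ (n - 1) * α ^ j)
    (hb'0 : b' 0 = a' 0 / β)
    (hb'n : ∀ n : ℕ, 1 ≤ n → b' n = a' n * β ^ (n - 1))
    (B B' : ℝ → ℝ)
    (hB : ∀ x : ℝ, B x = ∑' n : ℕ, b n * x ^ n)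
    (hB' : ∀ x : ℝ, B' x = ∑' n : ℕ, b' n * x ^ n)
    (fs : ℝ → ℝ) (hfs : ∀ x : ℝ, fs x = 1 - B 0 - B 1 + B x - B' (1 - x)) :
    ∀ x ∈ Set.Icc (0:ℝ) 1, fs x = (f (β * x + α) - α) / β := by
  have hβ0 : 0 < β := by linarith
  have zero_series : ∀ c : ℕ → ℝ, ∑' n : ℕ, c n * (0 : ℝ) ^ n = c 0 := fun c => by
    rw [tsum_eq_single 0 fun n hn => by simp [hn]]
    simp
  have B_eq : ∀ x ∈ Set.Icc (0 : ℝ) 1, β * B x = a 0 + A (β * x + α) - A α := by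
    rintro x ⟨hx0, hx1⟩
    have hs := hasSum_binomial_expansion ha hsa (mul_nonneg hβ0.le hx0) hα0 (by nlinarith)
    have hterm : ∀ n : ℕ,
        (∑' j : ℕ, a (n + 1 + j) * ((n + 1 + j).choose (n + 1) : ℝ) * α ^ j) *
          (β * x) ^ (n + 1) = β * (b (n + 1) * x ^ (n + 1)) := fun n => by
      rw [hbn (n + 1) (by omega), Nat.add_sub_cancel]
      have : ∀ j : ℕ, a (n + 1 + j) * ((n + 1 + j).choose (n + 1) : ℝ) * β ^ n * α ^ j =
          a (n + 1 + j) * ((n + 1 + j).choose (n + 1) : ℝ) * α ^ j * β ^ n :=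
        fun j => by ring
      simp only [this, tsum_mul_right]
      ring
    have hsb : Summable fun n : ℕ => b n * x ^ n := by
      rw [← summable_nat_add_iff 1, ← summable_mul_left_iff hβ0.ne']
      exact ((summable_nat_add_iff 1).2 hs.summable).congr hterm
    have h1 := hs.summable.tsum_eq_zero_add
    rw [hs.tsum_eq] at h1
    simp only [hterm, tsum_mul_left] at h1
    rw [hB, hsb.tsum_eq_zero_add, hA, hA, hb0, h1]
    simp
    field_simp
    ring
  have B'_eq : ∀ x : ℝ, β * B' x = A' (β * x) := fun x => by
    rw [hB', hA', ← tsum_mul_left]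
    refine tsum_congr fun n => ?_
    rcases n with _ | n
    · simp [hb'0]
      field_simp
    · rw [hb'n (n + 1) (by omega), Nat.add_sub_cancel]
      ring
  have hB0 : β * B 0 = a 0 := by
    rw [hB, zero_series, hb0]
    field_simp
  have hA0 : A 0 = a 0 := by rw [hA, zero_series]
  intro x hx
  have h1 := B_eq 1 (by simp)
  have h2 := B_eq x hx
  have h3 := B'_eq (1 - x)
  rw [show β * 1 + α = 1 by rw [hβ]; ring] at h1
  rw [eq_div_iff hβ0.ne', hfs, hf, hA0,
    show 1 - (β * x + α) = β * (1 - x) by rw [hβ]; ring]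
  linear_combination h2 - h1 - hB0 - h3 + hβ
end
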